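/- arXiv:2605.18649 — 2 statements merged into one kernel-verified Lean document; each statement's English description precedes it below -/
import Mathlib

section
/- For any n×n matrices X₁, …, X_{2n} over a commutative ring, the standard polynomial of degree 2n vanishes: ∑_{σ ∈ S_{2n}} sgn(σ) · X_{σ(1)} X_{σ(2)} ⋯ X_{σ(2n)} = 0. -/
open Polynomial in
theorem AL_derivative_charpoly {n : ℕ} {C : Type*} [CommRing C] (B : Matrix (Fin n) (Fin n) C) :
    derivative B.charpoly = (B.charmatrix.adjugate).trace := by
  have h : ∀ i, B.charmatrix.adjugate i i
      = (B.charmatrix.updateCol i (Pi.single i 1)).det := by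
    intro i
    have := congrFun (congrFun (Matrix.adjugate_transpose B.charmatrix) i) i
    rw [Matrix.transpose_apply] at this
    rw [this, Matrix.adjugate_apply, Matrix.updateRow_transpose, Matrix.det_transpose]
  rw [Matrix.trace]
  simp only [Matrix.diag_apply, h]
  rw [Matrix.charpoly, Matrix.det_apply']
  simp only [Matrix.det_apply']
  rw [Finset.sum_comm, derivative_sum]
  refine Finset.sum_congr rfl fun σ _ => ?_
  rw [← Finset.mul_sum, derivative_intCast_mul, derivative_prod_finset]
  congr 1
  refine Finset.sum_congr rfl fun i _ => ?_
  rw [← Finset.mul_prod_erase _ _ (Finset.mem_univ i), mul_comm]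
  congr 1
  · simp only [Matrix.updateCol_self]
    by_cases h : σ i = i
    · simp [h, Matrix.charmatrix_apply_eq]
    · simp [h, Matrix.charmatrix_apply_ne]
  · refine Finset.prod_congr rfl fun j hj => ?_
    rw [Matrix.updateCol_ne (Finset.ne_of_mem_erase hj)]

theorem AL_bound {n : ℕ} {C : Type*} [CommRing C]
    (N : Matrix (Fin n) (Fin n) (Polynomial C)) : ∃ D, ∀ i j, (N i j).natDegree ≤ D := by
  obtain ⟨D, hD⟩ := (Set.finite_range
    fun ij : Fin n × Fin n => (N ij.1 ij.2).natDegree).bddAbove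
  exact ⟨D, fun i j => hD ⟨(i, j), rfl⟩⟩

open Polynomial in
theorem AL_nilp {n : ℕ} {C : Type*} [CommRing C]
    (htf : ∀ m : ℤ, m ≠ 0 → ∀ x : C, (m : C) * x = 0 → x = 0)
    (B : Matrix (Fin n) (Fin n) C) (hB : ∀ k, 0 < k → (B ^ k).trace = 0) : B ^ n = 0 := by
  rcases subsingleton_or_nontrivial C with hC | hC
  · exact Subsingleton.elim _ _
  set p := B.charpoly with hp
  set N := B.charmatrix.adjugate with hN
  let cB : Matrix (Fin n) (Fin n) C[X] := B.map Polynomial.C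
  have hcB : ∀ k, cB ^ k = (B ^ k).map Polynomial.C := fun k => by
    have := map_pow (Polynomial.C.mapMatrix (m := Fin n)) B k
    simpa [cB] using this.symm
  have h1 : (X : C[X]) • N = cB * N + p • 1 := by
    have := Matrix.mul_adjugate B.charmatrix
    rw [Matrix.charmatrix, sub_mul, ← Matrix.charmatrix, ← hN] at this
    rw [hp, Matrix.charpoly, ← this]
    simp [cB, Matrix.scalar_apply, ← Matrix.smul_eq_diagonal_mul]
  have h2 : ∀ j, (X : C[X]) * (cB ^ j * N).trace
      = (cB ^ (j+1) * N).trace + p * Polynomial.C ((B ^ j).trace) := by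
    intro j
    have := congrArg (fun M => (cB ^ j * M).trace) h1
    simp only [Matrix.mul_smul, Matrix.trace_smul, mul_add, Matrix.trace_add, mul_one] at this
    rw [smul_eq_mul, smul_eq_mul] at this
    rw [this, pow_succ, mul_assoc, hcB j]
    congr 2
    simp [Matrix.trace]
  have h3 : ∀ m, (X : C[X]) ^ m * (cB * N).trace = (cB ^ (m+1) * N).trace := by
    intro m
    induction m with
    | zero => simp
    | succ m ih =>
      rw [pow_succ', mul_assoc, ih, h2, hB _ (Nat.succ_pos _)]
      simp
  have h4 : (cB * N).trace = 0 := by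
    ext k
    obtain ⟨D, hD⟩ := AL_bound N
    have := congrArg (fun q => q.coeff (k + (D+1))) (h3 (D+1))
    simp only [coeff_X_pow_mul] at this
    rw [this, hcB]
    simp only [Matrix.trace, Matrix.diag_apply, Matrix.mul_apply, Matrix.map_apply,
      finset_sum_coeff, coeff_C_mul, coeff_zero]
    refine Finset.sum_eq_zero fun i _ => Finset.sum_eq_zero fun j _ => ?_
    rw [coeff_eq_zero_of_natDegree_lt, mul_zero]
    have := hD j i
    omega
  have h5 : X * derivative p = (n : C[X]) * p := by
    rw [hp, AL_derivative_charpoly, ← hN, ← hp]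
    have := h2 0
    simp only [pow_zero, one_mul, zero_add, pow_one, h4] at this
    rw [this]
    simp [mul_comm]
  have h6 : ∀ k, k ≠ n → p.coeff k = 0 := by
    intro k hk
    have := congrArg (fun q => q.coeff k) h5
    apply htf ((k : ℤ) - n) (by omega)
    rw [← C_eq_natCast, coeff_C_mul] at this
    push_cast
    rw [sub_mul, ← this]
    rcases k with _ | k
    · simp
    · simp [coeff_X_mul, coeff_derivative, mul_comm]
  have h7 : p = X ^ n := by
    ext k
    rw [coeff_X_pow]
    split_ifs with hk
    · have := B.charpoly_monic.coeff_natDegree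
      rw [Matrix.charpoly_natDegree_eq_dim, Fintype.card_fin] at this
      rw [hk, this]
    · exact h6 k hk
  have := Matrix.aeval_self_charpoly B
  rw [← hp, h7] at this
  simpa using this

theorem AL_rosset {n : ℕ} {R E : Type*} [CommRing R] [Ring E] [Algebra R E]
    (htf : ∀ m : ℤ, m ≠ 0 → ∀ x : E, (m : E) * x = 0 → x = 0)
    (A : Matrix (Fin n) (Fin n) E)
    (hanti : ∀ i j k l, A i j * A k l = - (A k l * A i j))
    (hc : ∀ i j k l, A i j * A k l ∈ Subalgebra.center R E) : A ^ (2 * n) = 0 := by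
  let B : Matrix (Fin n) (Fin n) (Subalgebra.center R E) :=
    fun i j => ⟨(A * A) i j, by
      rw [Matrix.mul_apply]; exact Subalgebra.sum_mem _ fun k _ => hc _ _ _ _⟩
  let F := (Subalgebra.center R E).val.toRingHom
  have hF : Function.Injective F := Subtype.val_injective
  have hBA : F.mapMatrix B = A * A := by ext i j; rfl
  have hpow : ∀ k, F.mapMatrix (B ^ k) = A ^ (2 * k) := by
    intro k; rw [map_pow, hBA, pow_mul, pow_two]
  have hcen : ∀ k i j (x : E), x * F ((B ^ k) i j) = F ((B ^ k) i j) * x := by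
    intro k i j x
    exact Subalgebra.mem_center_iff.1 ((B ^ k) i j).2 x
  have hBn : B ^ n = 0 := by
    apply AL_nilp
    · intro m hm x hx
      apply hF
      rw [map_zero]
      apply htf m hm
      have := congrArg F hx
      simpa using this
    · intro k hk
      obtain ⟨k, rfl⟩ : ∃ l, k = l + 1 := ⟨k - 1, by omega⟩
      apply hF
      have e1 : F ((B ^ (k+1)).trace) = (A * (A * F.mapMatrix (B ^ k))).trace := by
        rw [← mul_assoc, ← hBA, ← map_mul, ← pow_succ']
        simp [Matrix.trace]
      have e2 : F ((B ^ (k+1)).trace) = (A * F.mapMatrix (B ^ k) * A).trace := by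
        have : A * F.mapMatrix (B ^ k) * A = F.mapMatrix (B ^ (k+1)) := by
          rw [hpow, hpow, ← pow_succ', ← pow_succ]; congr 1
        rw [this]
        simp [Matrix.trace]
      have e3 : (A * (A * F.mapMatrix (B ^ k))).trace
          = - (A * F.mapMatrix (B ^ k) * A).trace := by
        simp only [Matrix.trace, Matrix.diag_apply, Matrix.mul_apply (M := A), ← Finset.sum_neg_distrib]
        rw [Finset.sum_comm]
        refine Finset.sum_congr rfl fun j _ => ?_
        rw [Matrix.mul_apply, ← Finset.sum_neg_distrib]
        refine Finset.sum_congr rfl fun i _ => ?_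
        rw [Matrix.mul_apply, Finset.mul_sum, Finset.sum_mul, ← Finset.sum_neg_distrib]
        refine Finset.sum_congr rfl fun l _ => ?_
        rw [RingHom.mapMatrix_apply, Matrix.map_apply, ← mul_assoc, hanti, mul_assoc (A j l),
          ← hcen, neg_mul, mul_assoc]
      rw [map_zero]
      apply htf 2 (by norm_num)
      have : F ((B ^ (k+1)).trace) = - F ((B ^ (k+1)).trace) := by
        conv_lhs => rw [e1, e3, ← e2]
      push_cast
      rw [two_mul]
      nth_rewrite 1 [this]
      simp
  rw [← hpow, hBn, map_zero]

theorem AL_ext_center {R M : Type*} [CommRing R] [AddCommGroup M] [Module R M] (x y : M) :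
    ExteriorAlgebra.ι R x * ExteriorAlgebra.ι R y ∈
      Subalgebra.center R (ExteriorAlgebra R M) := by
  have sw : ∀ a b : M, ExteriorAlgebra.ι R a * ExteriorAlgebra.ι R b
      = - (ExteriorAlgebra.ι R b * ExteriorAlgebra.ι R a) := fun a b =>
    eq_neg_of_add_eq_zero_left (ExteriorAlgebra.ι_add_mul_swap a b)
  rw [Subalgebra.mem_center_iff]
  intro b
  induction b using ExteriorAlgebra.induction with
  | algebraMap r => exact Algebra.commutes r _
  | ι z => rw [← mul_assoc, sw z x, neg_mul, mul_assoc, sw z y, mul_neg, neg_neg, mul_assoc]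
  | mul a b ha hb => rw [mul_assoc, hb, ← mul_assoc, ha, mul_assoc]
  | add a b ha hb => rw [add_mul, mul_add, ha, hb]

theorem AL_expand {n N : ℕ} {R E : Type*} [CommRing R] [Ring E] [Algebra R E]
    (X : Fin N → Matrix (Fin n) (Fin n) R) (e : Fin N → E)
    (A : Matrix (Fin n) (Fin n) E) (hA : ∀ i j, A i j = ∑ k, X k i j • e k) (m : ℕ) (i j : Fin n) :
    (A ^ m) i j = ∑ f : Fin m → Fin N,
      (List.ofFn fun k => X (f k)).prod i j • (List.ofFn fun k => e (f k)).prod := by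
  induction m generalizing i j with
  | zero => by_cases h : i = j <;> simp [Matrix.one_apply, h]
  | succ m ih =>
    rw [pow_succ', Matrix.mul_apply, ← (Fin.consEquiv (fun _ => Fin N)).sum_comp,
      Fintype.sum_prod_type]
    simp only [ih, hA, Fin.consEquiv_apply, List.ofFn_succ, Fin.cons_zero, Fin.cons_succ,
      List.prod_cons, Matrix.mul_apply, Finset.sum_mul, Finset.mul_sum, Finset.sum_smul,
      smul_mul_smul_comm]
    rw [Finset.sum_comm]
    simp only [Finset.sum_comm (s := (Finset.univ : Finset (Fin n)))]
    rw [Finset.sum_comm]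

theorem AL_rat {R : Type*} [CommRing R] [Algebra ℚ R] (n : ℕ)
    (X : Fin (2 * n) → Matrix (Fin n) (Fin n) R) :
    ∑ σ : Equiv.Perm (Fin (2 * n)),
      (Equiv.Perm.sign σ : ℤ) • (List.ofFn fun i => X (σ i)).prod = 0 := by
  let A : Matrix (Fin n) (Fin n) (ExteriorAlgebra R (Fin (2 * n) → R)) :=
    fun i j => ExteriorAlgebra.ι R (fun k => X k i j)
  let v : Fin (2 * n) → Fin (2 * n) → R := fun k => Pi.single k 1
  have hA : ∀ i j, A i j = ∑ k, X k i j • ExteriorAlgebra.ι R (v k) := by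
    intro i j
    simp only [A, ← map_smul, ← map_sum]
    congr 1
    ext k
    rw [Finset.sum_apply]
    simp [v, Pi.single_apply]
  have h0 : A ^ (2 * n) = 0 := by
    apply AL_rosset (R := R)
    · intro m hm x hx
      have : ((algebraMap ℚ R ((m : ℚ)⁻¹ * m)) : R) • x = 0 := by
        rw [map_mul, mul_smul, map_intCast, Algebra.smul_def (m : R) x, map_intCast, hx, smul_zero]
      rwa [inv_mul_cancel₀ (by exact_mod_cast hm), map_one, one_smul] at this
    · intro i j k l
      exact eq_neg_of_add_eq_zero_left (ExteriorAlgebra.ι_add_mul_swap _ _)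
    · intro i j k l
      exact AL_ext_center _ _
  let φ : ExteriorAlgebra R (Fin (2 * n) → R) →ₗ[R] R := ExteriorAlgebra.liftAlternating
    (Function.update 0 (2 * n) Matrix.detRowAlternating)
  have hφ : ∀ f : Fin (2 * n) → Fin (2 * n),
      φ (List.ofFn fun k => ExteriorAlgebra.ι R (v (f k))).prod
        = ∑ σ : Equiv.Perm (Fin (2 * n)), ((Equiv.Perm.sign σ : ℤ) : R) * if f = σ then 1 else 0 := by
    intro f
    rw [← ExteriorAlgebra.ιMulti_apply (R := R) (fun k => v (f k)),
      ExteriorAlgebra.liftAlternating_apply_ιMulti, Function.update_self]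
    change Matrix.det (Matrix.of fun k => v (f k)) = _
    rw [← Matrix.det_transpose, Matrix.det_apply']
    refine Finset.sum_congr rfl fun σ _ => ?_
    congr 1
    simp only [Matrix.transpose_apply, Matrix.of_apply, v, Pi.single_apply]
    rw [Fintype.prod_boole]
    congr 1
    simp [funext_iff, eq_comm]
  ext i j
  have := congrArg (fun M => φ (M i j)) h0
  simp only [AL_expand X _ A hA, map_sum, map_smul, hφ, Matrix.zero_apply, map_zero] at this
  rw [Matrix.zero_apply, ← this]
  simp only [Matrix.sum_apply, smul_eq_mul, Finset.mul_sum]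
  rw [Finset.sum_comm]
  refine Finset.sum_congr rfl fun σ _ => ?_
  simp [mul_comm]

theorem AL_map {R S : Type*} [CommRing R] [CommRing S] (F : R →+* S) (n : ℕ)
    (X : Fin (2 * n) → Matrix (Fin n) (Fin n) R) :
    F.mapMatrix (∑ σ : Equiv.Perm (Fin (2 * n)),
      (Equiv.Perm.sign σ : ℤ) • (List.ofFn fun i => X (σ i)).prod) =
    ∑ σ : Equiv.Perm (Fin (2 * n)),
      (Equiv.Perm.sign σ : ℤ) • (List.ofFn fun i => F.mapMatrix (X (σ i))).prod := by
  simp only [map_sum, map_zsmul, map_list_prod, List.map_ofFn, Function.comp_def]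

/-- Amitsur–Levitzki theorem: the standard polynomial of degree `2n` vanishes
identically on `n × n` matrices over a commutative ring. -/
theorem amitsur_levitzki {R : Type*} [CommRing R] (n : ℕ)
    (X : Fin (2 * n) → Matrix (Fin n) (Fin n) R) :
    ∑ σ : Equiv.Perm (Fin (2 * n)),
      (Equiv.Perm.sign σ : ℤ) • (List.ofFn fun i => X (σ i)).prod = 0 := by
  let I := Fin (2 * n) × Fin n × Fin n
  let Y : Fin (2 * n) → Matrix (Fin n) (Fin n) (MvPolynomial I ℤ) :=
    fun k i j => MvPolynomial.X (k, i, j)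
  let F : MvPolynomial I ℤ →+* R := MvPolynomial.eval₂Hom (Int.castRingHom R)
    (fun t => X t.1 t.2.1 t.2.2)
  have hY : ∀ k, F.mapMatrix (Y k) = X k := by
    intro k; ext i j; exact MvPolynomial.eval₂_X _ _ _
  let G : MvPolynomial I ℤ →+* MvPolynomial I ℚ := MvPolynomial.map (Int.castRingHom ℚ)
  have hG : Function.Injective G := MvPolynomial.map_injective _ Int.cast_injective
  have h1 := AL_map G n Y
  rw [AL_rat n (fun k => G.mapMatrix (Y k))] at h1
  have h2 : (∑ σ : Equiv.Perm (Fin (2 * n)),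
      (Equiv.Perm.sign σ : ℤ) • (List.ofFn fun i => Y (σ i)).prod) = 0 := by
    ext1 i j
    apply hG
    have := congrFun (congrFun h1 i) j
    rw [Matrix.zero_apply, map_zero]
    exact this
  have h3 := AL_map F n Y
  rw [h2, map_zero] at h3
  simp only [hY] at h3
  exact h3.symm
end

section
/- Let M be a monoid, n ≥ 1, and ρ : F(a,b) → GL_n(K) any group homomorphism from the free group on two generators into the invertible n×n matrices over a field K. Set m = 2n, x_i = b^i a, and W_σ = a x_{σ(1)} ⋯ x_{σ(m)} for σ ∈ S_m. Then ∑_{σ ∈ S_m} sgn(σ) · tr(ρ(W_σ)) = 0. -/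
/-- For any representation `ρ : F(a,b) → GL_n(K)`, with `m = 2n`, `x_i = b^i a`
(`1 ≤ i ≤ m`) and `W_σ = a x_{σ(1)} ⋯ x_{σ(m)}`, one has
`∑_{σ ∈ S_m} sgn(σ) · tr(ρ(W_σ)) = 0`. -/
theorem trace_alternating_sum_vanishes {K : Type*} [Field K] (n : ℕ) (hn : 1 ≤ n)
    (ρ : FreeGroup (Fin 2) →* Matrix.GeneralLinearGroup (Fin n) K)
    (a b : FreeGroup (Fin 2)) (ha : a = FreeGroup.of 0) (hb : b = FreeGroup.of 1)
    (x : Fin (2 * n) → FreeGroup (Fin 2)) (hx : ∀ i, x i = b ^ ((i : ℕ) + 1) * a) :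
    ∑ σ : Equiv.Perm (Fin (2 * n)),
      ((Equiv.Perm.sign σ : ℤ) : K) *
        Matrix.trace (ρ (a * (List.ofFn fun i => x (σ i)).prod) : Matrix (Fin n) (Fin n) K)
      = 0 := by
  -- The `2n` matrices `B^(i+1) A` are linearly dependent by Cayley–Hamilton, so any
  -- alternating multilinear form vanishes on them.
  let A : Matrix (Fin n) (Fin n) K := ρ a
  let B : Matrix (Fin n) (Fin n) K := ρ b
  let v : Fin (2 * n) → Matrix (Fin n) (Fin n) K := fun i => (ρ (x i) : Matrix (Fin n) (Fin n) K)
  have hv : ∀ i, v i = B * B ^ (i : ℕ) * A := by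
    intro i
    simp only [v, A, B, hx, map_mul, map_pow, Units.val_mul, Units.val_pow_eq_pow_val, pow_succ']
  have hdep : ¬ LinearIndependent K v := by
    intro h
    rw [Fintype.linearIndependent_iff] at h
    have hdeg : B.charpoly.natDegree = n := by
      simp [Matrix.charpoly_natDegree_eq_dim]
    have key := h (fun i => B.charpoly.coeff i) (by
      have h0 := Matrix.aeval_self_charpoly B
      rw [Polynomial.aeval_eq_sum_range' (n := 2 * n) (by omega), ← Fin.sum_univ_eq_sum_range
        (fun i => B.charpoly.coeff i • B ^ i)] at h0
      calc ∑ i : Fin (2 * n), B.charpoly.coeff (i : ℕ) • v i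
          = B * (∑ i : Fin (2 * n), B.charpoly.coeff (i : ℕ) • B ^ (i : ℕ)) * A := by
            simp [hv, Finset.mul_sum, Finset.sum_mul]
        _ = 0 := by rw [h0]; simp) ⟨n, by omega⟩
    have h1 : B.charpoly.coeff n = 1 := by
      have := (Matrix.charpoly_monic B).coeff_natDegree
      rwa [hdeg] at this
    simp [h1] at key
  let L : Matrix (Fin n) (Fin n) K →ₗ[K] K :=
    (Matrix.traceLinearMap (Fin n) K K) ∘ₗ (LinearMap.mulLeft K A)
  let F : MultilinearMap K (fun _ : Fin (2 * n) => Matrix (Fin n) (Fin n) K) K :=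
    L.compMultilinearMap (MultilinearMap.mkPiAlgebraFin K (2 * n) (Matrix (Fin n) (Fin n) K))
  have hz := AlternatingMap.map_linearDependent (MultilinearMap.alternatization F) v hdep
  rw [MultilinearMap.alternatization_apply] at hz
  rw [← hz]
  refine Finset.sum_congr rfl fun σ _ => ?_
  have hp : ((ρ (List.ofFn fun i => x (σ i)).prod : Matrix.GeneralLinearGroup (Fin n) K) :
      Matrix (Fin n) (Fin n) K) = (List.ofFn fun i => v (σ i)).prod := by
    rw [map_list_prod, ← Units.coeHom_apply, map_list_prod, List.map_map, List.map_ofFn]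
    rfl
  rw [map_mul, Units.val_mul, hp]
  simp [F, L, A, Units.smul_def, zsmul_eq_mul]
end
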